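/- arXiv:1106.2294 — 2 statements merged into one kernel-verified Lean document; each statement's English description precedes it below -/
import Mathlib

section
/- Let ρ_f ≥ 1 and ρ_c ≥ 1, and let α : C → ℝ≥0 satisfy, for every site i ∈ F and every subset C' ⊆ C, the inequality ∑_{j∈C'} α_j ≤ ρ_f·f_i + ρ_c·∑_{j∈C'} c_{ij}. Then for every feasible integral solution (x, y) of the UFTRA integer program, with facility cost F_SOL = ∑_{i∈F} f_i y_i and connection cost C_SOL = ∑_{i∈F}∑_{j∈C} c_{ij} x_{ij}, we have ∑_{j∈C} r_j α_j ≤ ρ_f·F_SOL + ρ_c·C_SOL. -/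
/-- If every subset sum of `g` is at most `A`, then a combination of the values of `g` with
weights in `[0, b]` is at most `b * A`. -/
theorem sum_weight_mul_le_of_subset_sum_le {ι : Type*} [Fintype ι] (g w : ι → ℝ) (A b : ℝ)
    (hb : 0 ≤ b) (hw0 : ∀ j, 0 ≤ w j) (hwb : ∀ j, w j ≤ b)
    (hg : ∀ s : Finset ι, ∑ j ∈ s, g j ≤ A) : ∑ j, w j * g j ≤ b * A := by
  classical
  calc ∑ j, w j * g j ≤ ∑ j, if 0 ≤ g j then b * g j else 0 := by
        refine Finset.sum_le_sum fun j _ => ?_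
        split_ifs with h
        · exact mul_le_mul_of_nonneg_right (hwb j) h
        · exact mul_nonpos_of_nonneg_of_nonpos (hw0 j) (not_le.mp h).le
    _ = b * ∑ j with 0 ≤ g j, g j := by rw [← Finset.sum_filter, Finset.mul_sum]
    _ ≤ b * A := mul_le_mul_of_nonneg_left (hg _) hb

/-- Inverse dual fitting principle for UFTRA: if
`∑_{j ∈ C'} α j ≤ ρ_f · f i + ρ_c · ∑_{j ∈ C'} c i j` for every site `i` and
subset `C'` of clients, then for every feasible integral solution `(x, y)` of
the UFTRA integer program, `∑ j, r j * α j ≤ ρ_f · F_SOL + ρ_c · C_SOL`. -/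
theorem uftra_inverse_dual_fitting
    {F C : Type*} [Fintype F] [Fintype C]
    (f : F → ℝ) (c : F → C → ℝ) (r : C → ℕ)
    (hf : ∀ i, 0 ≤ f i) (hc : ∀ i j, 0 ≤ c i j) (hr : ∀ j, 1 ≤ r j)
    (ρf ρc : ℝ) (hρf : 1 ≤ ρf) (hρc : 1 ≤ ρc)
    (α : C → ℝ) (hα0 : ∀ j, 0 ≤ α j)
    (hfit : ∀ i : F, ∀ C' : Finset C,
        ∑ j ∈ C', α j ≤ ρf * f i + ρc * ∑ j ∈ C', c i j)
    (x : F → C → ℕ) (y : F → ℕ)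
    (hrx : ∀ j, r j ≤ ∑ i, x i j) (hxy : ∀ i j, x i j ≤ y i) :
    ∑ j, (r j : ℝ) * α j
      ≤ ρf * (∑ i, f i * (y i : ℝ)) + ρc * (∑ i, ∑ j, c i j * (x i j : ℝ)) := by
  have hsite : ∀ i, ∑ j, (x i j : ℝ) * (α j - ρc * c i j) ≤ y i * (ρf * f i) := fun i =>
    sum_weight_mul_le_of_subset_sum_le _ _ _ _ (Nat.cast_nonneg _) (fun _ => Nat.cast_nonneg _)
      (fun j => Nat.cast_le.mpr (hxy i j)) fun s => by
        rw [Finset.sum_sub_distrib, ← Finset.mul_sum]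
        linarith [hfit i s]
  calc ∑ j, (r j : ℝ) * α j ≤ ∑ j, ∑ i, (x i j : ℝ) * α j := by
        refine Finset.sum_le_sum fun j _ => ?_
        rw [← Finset.sum_mul]
        exact mul_le_mul_of_nonneg_right (mod_cast hrx j) (hα0 j)
    _ = ∑ i, ∑ j, (x i j : ℝ) * α j := Finset.sum_comm
    _ ≤ ∑ i, (ρf * (f i * y i) + ρc * ∑ j, c i j * (x i j : ℝ)) := by
        refine Finset.sum_le_sum fun i _ => ?_
        have hsplit : ∑ j, (x i j : ℝ) * α j
            = ∑ j, (x i j : ℝ) * (α j - ρc * c i j) + ρc * ∑ j, c i j * (x i j : ℝ) := by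
          rw [Finset.mul_sum, ← Finset.sum_add_distrib]
          exact Finset.sum_congr rfl fun j _ => by ring
        linarith [hsite i]
    _ = _ := by rw [Finset.sum_add_distrib, ← Finset.mul_sum, ← Finset.mul_sum]
end

section
/- Let (y^d, x) be a feasible solution of the GCFTRA integer program, i.e., y_i^d ∈ {0,1}, x_{ij} a nonnegative integer with x_{ij} ≤ ∑_{d=1}^{R_i} y_i^d for all i, j, and ∑_i x_{ij} ≥ r_j for all j. Then there exists a feasible solution (y, x') of the FTFL integer program over K (y_k ∈ {0,1}, x'_{kj} ∈ {0,1}, x'_{kj} ≤ y_k, ∑_{k∈K} x'_{kj} ≥ r_j) whose objective value equals that of (y^d, x): namely, take y_{(i,d)} = y_i^d and, for each pair (i, j), choose x'_{(i,d),j} = 1 for exactly x_{ij} indices d among those with y_i^d = 1. Consequently, the optimal values of the GCFTRA and FTFL integer programs coincide. -/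
/-- Every natural number below the sum of `y` is the sum of some function dominated by `y`. -/
theorem exists_le_sum_eq_of_le_sum {ι : Type*} [Fintype ι] (y : ι → ℕ) (n : ℕ)
    (hn : n ≤ ∑ i, y i) : ∃ z : ι → ℕ, (∀ i, z i ≤ y i) ∧ ∑ i, z i = n := by
  classical
  induction n with
  | zero => exact ⟨0, fun _ => Nat.zero_le _, by simp⟩
  | succ n ih =>
    obtain ⟨z, hzy, hz⟩ := ih (by omega)
    obtain ⟨i, -, hi⟩ := Finset.exists_lt_of_sum_lt
      (show ∑ i, z i < ∑ i, y i by omega)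
    refine ⟨z + Pi.single i 1, fun k => ?_, by simp [Finset.sum_add_distrib, hz]⟩
    by_cases hk : k = i
    · subst hk
      simpa using hi
    · simpa [hk] using hzy k

/-- The FTFL objective agrees with the GCFTRA objective when the connections of each site
aggregate to the GCFTRA connections. -/
theorem ftfl_cost_eq_gcftra_cost {F C : Type*} [Fintype F] [Fintype C] (R : F → ℕ)
    (f : (i : F) → Fin (R i) → ℝ) (c : F → C → ℝ)
    (yk : (Σ i : F, Fin (R i)) → ℕ) (xk : (Σ i : F, Fin (R i)) → C → ℕ) (x : F → C → ℕ)
    (hx : ∀ i j, ∑ d : Fin (R i), xk ⟨i, d⟩ j = x i j) :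
    ∑ k : Σ i : F, Fin (R i), f k.1 k.2 * (yk k : ℝ) +
        ∑ k : Σ i : F, Fin (R i), ∑ j, c k.1 j * (xk k j : ℝ)
      = ∑ i, ∑ d : Fin (R i), f i d * (yk ⟨i, d⟩ : ℝ) +
        ∑ i, ∑ j, c i j * (x i j : ℝ) := by
  rw [Fintype.sum_sigma, Fintype.sum_sigma]
  congr 1
  refine Finset.sum_congr rfl fun i _ => ?_
  rw [Finset.sum_comm]
  refine Finset.sum_congr rfl fun j _ => ?_
  rw [← hx i j, Nat.cast_sum, Finset.mul_sum]

/-- A feasible GCFTRA solution splits into 0-1 FTFL connections, site by site. -/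
theorem exists_ftfl_connections {F C : Type*} [Fintype F] (R : F → ℕ) (r : C → ℕ)
    (y : (i : F) → Fin (R i) → ℕ) (x : F → C → ℕ)
    (hy01 : ∀ i d, y i d ≤ 1)
    (hxy : ∀ i j, x i j ≤ ∑ d : Fin (R i), y i d)
    (hrx : ∀ j, r j ≤ ∑ i, x i j) :
    ∃ x' : (Σ i : F, Fin (R i)) → C → ℕ,
      (∀ k j, x' k j ≤ 1) ∧
      (∀ (k : Σ i : F, Fin (R i)) j, x' k j ≤ y k.1 k.2) ∧
      (∀ j, r j ≤ ∑ k : Σ i : F, Fin (R i), x' k j) ∧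
      (∀ i j, ∑ d : Fin (R i), x' ⟨i, d⟩ j = x i j) := by
  choose z hzy hz using fun i j => exists_le_sum_eq_of_le_sum (y i) (x i j) (hxy i j)
  refine ⟨fun k j => z k.1 j k.2, fun k j => (hzy _ _ _).trans (hy01 _ _),
    fun k j => hzy _ _ _, fun j => ?_, hz⟩
  rw [Fintype.sum_sigma]
  simpa only [hz] using hrx j

/-- From GCFTRA to FTFL: a feasible solution `(y, x)` of the GCFTRA
integer program yields a feasible 0-1 solution `(y, x')` of the FTFL integer
program over `K = Σ i, Fin (R i)` (taking `y_{(i,d)} = y_i^d` and choosing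
`x'_{(i,d),j} = 1` for exactly `x i j` indices `d` among those with `y i d = 1`)
with equal objective value; consequently the optimal values of the GCFTRA and
FTFL integer programs coincide. -/
theorem ftfl_of_gcftra
    {F C : Type*} [Fintype F] [Fintype C]
    (R : F → ℕ) (hR : ∀ i, 1 ≤ R i)
    (f : (i : F) → Fin (R i) → ℝ) (c : F → C → ℝ) (r : C → ℕ)
    (hf : ∀ i d, 0 ≤ f i d) (hc : ∀ i j, 0 ≤ c i j)
    (y : (i : F) → Fin (R i) → ℕ) (x : F → C → ℕ)
    (hy01 : ∀ i d, y i d ≤ 1)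
    (hxy : ∀ i j, x i j ≤ ∑ d : Fin (R i), y i d)
    (hrx : ∀ j, r j ≤ ∑ i, x i j) :
    (∃ x' : (Σ i : F, Fin (R i)) → C → ℕ,
      (∀ k j, x' k j ≤ 1) ∧
      (∀ (k : Σ i : F, Fin (R i)) j, x' k j ≤ y k.1 k.2) ∧
      (∀ j, r j ≤ ∑ k : Σ i : F, Fin (R i), x' k j) ∧
      (∀ i j, ∑ d : Fin (R i), x' ⟨i, d⟩ j = x i j) ∧
      ∑ k : Σ i : F, Fin (R i), f k.1 k.2 * (y k.1 k.2 : ℝ) +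
          ∑ k : Σ i : F, Fin (R i), ∑ j, c k.1 j * (x' k j : ℝ)
        = ∑ i, ∑ d : Fin (R i), f i d * (y i d : ℝ) +
          ∑ i, ∑ j, c i j * (x i j : ℝ)) ∧
    -- the optimal values of the two integer programs coincide
    sInf {v : ℝ | ∃ (y' : (i : F) → Fin (R i) → ℕ) (x'' : F → C → ℕ),
        (∀ i d, y' i d ≤ 1) ∧
        (∀ i j, x'' i j ≤ ∑ d : Fin (R i), y' i d) ∧
        (∀ j, r j ≤ ∑ i, x'' i j) ∧
        v = ∑ i, ∑ d : Fin (R i), f i d * (y' i d : ℝ) +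
            ∑ i, ∑ j, c i j * (x'' i j : ℝ)}
      = sInf {v : ℝ | ∃ (yk : (Σ i : F, Fin (R i)) → ℕ)
          (xk : (Σ i : F, Fin (R i)) → C → ℕ),
        (∀ k, yk k ≤ 1) ∧ (∀ k j, xk k j ≤ 1) ∧ (∀ k j, xk k j ≤ yk k) ∧
        (∀ j, r j ≤ ∑ k : Σ i : F, Fin (R i), xk k j) ∧
        v = ∑ k : Σ i : F, Fin (R i), f k.1 k.2 * (yk k : ℝ) +
            ∑ k : Σ i : F, Fin (R i), ∑ j, c k.1 j * (xk k j : ℝ)} := by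
  constructor
  · obtain ⟨x', h01, hle, hr, hx⟩ := exists_ftfl_connections R r y x hy01 hxy hrx
    exact ⟨x', h01, hle, hr, hx,
      ftfl_cost_eq_gcftra_cost R f c (fun k => y k.1 k.2) x' x hx⟩
  · congr 1
    ext v
    constructor
    · rintro ⟨y', x'', hy', hxy', hr', rfl⟩
      obtain ⟨x', h01, hle, hr, hx⟩ := exists_ftfl_connections R r y' x'' hy' hxy' hr'
      exact ⟨fun k => y' k.1 k.2, x', fun k => hy' _ _, h01, hle, hr,
        (ftfl_cost_eq_gcftra_cost R f c (fun k => y' k.1 k.2) x' x'' hx).symm⟩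
    · rintro ⟨yk, xk, hyk, -, hle, hr, rfl⟩
      refine ⟨fun i d => yk ⟨i, d⟩, fun i j => ∑ d, xk ⟨i, d⟩ j, fun i d => hyk _,
        fun i j => Finset.sum_le_sum fun d _ => hle _ _, fun j => ?_,
        ftfl_cost_eq_gcftra_cost R f c yk xk _ fun _ _ => rfl⟩
      simpa only [Fintype.sum_sigma] using hr j
end
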